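/- arXiv:2501.03168 — 3 statements merged into one kernel-verified Lean document; each statement's English description precedes it below -/
import Mathlib

section
/- Let N ≥ 2 be an integer and for v ∈ E_N define I_β(v) = ∫₀¹ exp( β · log(e/s) · v(s)^N / s^{N−1} ) ds. Then the supremum of I_β over E_N is finite if and only if β ≤ 1; that is, sup_{v ∈ E_N} I_β(v) < ∞ holds precisely when β ≤ 1. -/
open MeasureTheory Real Set Filter

/-- `u` belongs to `E_N` with weak derivative `g` : `u` is absolutely continuous on `[0,1]`
(it is the integral of its weak derivative `g`), `u 0 = 0`, `|g|^N` is integrable on `(0,1)`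
and `∫₀¹ |g|^N = 1`. -/
def MemEN (N : ℕ) (u g : ℝ → ℝ) : Prop :=
  (∀ s ∈ Set.Icc (0:ℝ) 1, u s = ∫ t in (0:ℝ)..s, g t) ∧
  u 0 = 0 ∧
  IntervalIntegrable g MeasureTheory.volume 0 1 ∧
  MeasureTheory.IntegrableOn (fun t => |g t| ^ N) (Set.Ioc (0:ℝ) 1) ∧
  (∫ t in Set.Ioc (0:ℝ) 1, |g t| ^ N) = 1

/-- The Limiting-Bliss functional `I_β`. -/
noncomputable def Ifun (N : ℕ) (β : ℝ) (v : ℝ → ℝ) : ℝ :=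
  ∫ s in Set.Ioc (0:ℝ) 1,
    Real.exp (β * Real.log (Real.exp 1 / s) * (v s ^ N / s ^ (N - 1)))


lemma bliss_holder {μ : Measure ℝ} (N : ℕ) (hN : 2 ≤ N) (h w : ℝ → ENNReal)
    (hh : AEMeasurable h μ) (hw : AEMeasurable w μ)
    (hw0 : ∀ᵐ t ∂μ, w t ≠ 0) (hwt : ∀ᵐ t ∂μ, w t ≠ ⊤) :
    (∫⁻ t, h t ∂μ) ^ N ≤ (∫⁻ t, (h t * w t) ^ N ∂μ) *
      (∫⁻ t, ((w t)⁻¹) ^ ((N:ℝ) / (N - 1)) ∂μ) ^ (N - 1) := by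
  have hN' : (1:ℝ) < N := by exact_mod_cast hN
  have hc := Real.HolderConjugate.conjExponent hN'
  have hH := ENNReal.lintegral_mul_le_Lp_mul_Lq μ hc (hh.mul hw) hw.inv
  have e1 : ∫⁻ t, h t ∂μ = ∫⁻ t, (h * w * w⁻¹) t ∂μ := by
    apply lintegral_congr_ae
    filter_upwards [hw0, hwt] with t h0 h1
    simp [mul_assoc, ENNReal.mul_inv_cancel h0 h1]
  rw [← e1] at hH
  calc (∫⁻ t, h t ∂μ) ^ N ≤ _ := pow_le_pow_left' hH N
    _ = _ := by
      rw [mul_pow]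
      congr 1
      · rw [← ENNReal.rpow_natCast, ← ENNReal.rpow_mul, one_div,
          inv_mul_cancel₀ (by positivity), ENNReal.rpow_one]
        simp
      · rw [← ENNReal.rpow_natCast, ← ENNReal.rpow_mul, ← ENNReal.rpow_natCast]
        have : 1 / (N:ℝ).conjExponent * N = ((N - 1 : ℕ) : ℝ) := by
          rw [Real.conjExponent, Nat.cast_sub (by omega)]
          have : (N:ℝ) - 1 ≠ 0 := by linarith
          field_simp
          simp
        rw [this]
        rfl

lemma bliss_norm {N : ℕ} {u g : ℝ → ℝ} (h : MemEN N u g) :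
    ∫⁻ t in Ioc (0:ℝ) 1, ‖g t‖ₑ ^ N = 1 := by
  obtain ⟨-, -, -, hi, h1⟩ := h
  have := ofReal_integral_eq_lintegral_ofReal hi (by filter_upwards with t; positivity)
  rw [h1, ENNReal.ofReal_one] at this
  rw [this]
  congr 1; ext t
  rw [ENNReal.ofReal_pow (abs_nonneg _), Real.enorm_eq_ofReal_abs]

lemma bliss_meas {N : ℕ} {u g : ℝ → ℝ} (h : MemEN N u g) :
    AEMeasurable (fun t => ‖g t‖ₑ) (volume.restrict (Ioc (0:ℝ) 1)) := by
  obtain ⟨-, -, hi, -, -⟩ := h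
  rw [intervalIntegrable_iff_integrableOn_Ioc_of_le zero_le_one] at hi
  exact hi.1.aemeasurable.enorm

lemma bliss_le {N : ℕ} {u g : ℝ → ℝ} (h : MemEN N u g) {s : ℝ} (hs : s ∈ Ioc (0:ℝ) 1) :
    ‖u s‖ₑ ≤ ∫⁻ t in Ioc (0:ℝ) s, ‖g t‖ₑ := by
  rw [h.1 s ⟨hs.1.le, hs.2⟩, intervalIntegral.integral_of_le hs.1.le]
  exact enorm_integral_le_lintegral_enorm _

lemma bliss_le_one {N : ℕ} (hN : 2 ≤ N) {u g : ℝ → ℝ} (h : MemEN N u g) {s : ℝ}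
    (hs : s ∈ Ioc (0:ℝ) 1) : |u s| ^ N ≤ s ^ (N - 1) := by
  have hsub : Ioc (0:ℝ) s ⊆ Ioc 0 1 := Ioc_subset_Ioc_right hs.2
  have h1 := bliss_holder (μ := volume.restrict (Ioc (0:ℝ) s)) N hN (fun t => ‖g t‖ₑ) (fun _ => 1)
    ((bliss_meas h).mono_measure (Measure.restrict_mono hsub le_rfl)) aemeasurable_const
    (by simp) (by simp)
  simp only [mul_one, inv_one, ENNReal.one_rpow, lintegral_const, Measure.restrict_apply,
    MeasurableSet.univ, univ_inter, Real.volume_Ioc, sub_zero, one_mul] at h1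
  have h2 : ‖u s‖ₑ ^ N ≤ 1 * ENNReal.ofReal s ^ (N - 1) := by
    refine (pow_le_pow_left' (bliss_le h hs) N).trans (h1.trans ?_)
    gcongr
    rw [← bliss_norm h]
    exact lintegral_mono_set hsub
  rw [one_mul, Real.enorm_eq_ofReal_abs, ← ENNReal.ofReal_pow (abs_nonneg _),
    ← ENNReal.ofReal_pow hs.1.le] at h2
  exact (ENNReal.ofReal_le_ofReal_iff (by have := hs.1; positivity)).1 h2

lemma bliss_lint_half {s : ℝ} (hs : 0 < s) :
    ∫⁻ t in Ioc (0:ℝ) s, ENNReal.ofReal (t ^ (-(1/2) : ℝ)) = ENNReal.ofReal (2 * s ^ (1/2 : ℝ)) := by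
  have hi : IntervalIntegrable (fun t : ℝ => t ^ (-(1/2) : ℝ)) volume 0 s :=
    intervalIntegral.intervalIntegrable_rpow' (by norm_num)
  rw [← ofReal_integral_eq_lintegral_ofReal
    ((intervalIntegrable_iff_integrableOn_Ioc_of_le hs.le).1 hi)
    (by filter_upwards [ae_restrict_mem measurableSet_Ioc] with t ht
        exact Real.rpow_nonneg ht.1.le _),
    ← intervalIntegral.integral_of_le hs.le, integral_rpow (Or.inl (by norm_num))]
  congr 1
  norm_num
  ring

/-- Kernel for the Hardy inequality. -/
noncomputable def blissK (N : ℕ) (s t : ℝ) : ENNReal :=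
  ({p : ℝ × ℝ | p.2 ≤ p.1}).indicator
    (fun p => ENNReal.ofReal (2 ^ (N - 1) * p.1 ^ (-((N:ℝ) + 1) / 2) * p.2 ^ (((N:ℝ) - 1) / 2))) (s, t)

lemma bliss_hardy_pt {N : ℕ} (hN : 2 ≤ N) {u g : ℝ → ℝ} (h : MemEN N u g) {s : ℝ}
    (hs : s ∈ Ioc (0:ℝ) 1) :
    ‖u s / s‖ₑ ^ N ≤ ∫⁻ t in Ioc (0:ℝ) 1, blissK N s t * ‖g t‖ₑ ^ N := by
  have hs0 := hs.1
  have hN' : (1:ℝ) < N := by exact_mod_cast hN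
  have hsub : Ioc (0:ℝ) s ⊆ Ioc 0 1 := Ioc_subset_Ioc_right hs.2
  have h1 := bliss_holder (μ := volume.restrict (Ioc (0:ℝ) s)) N hN (fun t => ‖g t‖ₑ)
    (fun t => ENNReal.ofReal (t ^ (((N:ℝ) - 1) / (2 * N))))
    ((bliss_meas h).mono_measure (Measure.restrict_mono hsub le_rfl))
    (by fun_prop)
    (by filter_upwards [ae_restrict_mem measurableSet_Ioc] with t ht
        have := Real.rpow_pos_of_pos ht.1 (((N:ℝ) - 1) / (2 * N))
        simpa using this)
    (by simp)
  have e2 : ∫⁻ t in Ioc (0:ℝ) s, (ENNReal.ofReal (t ^ (((N:ℝ) - 1) / (2 * N))))⁻¹ ^ ((N:ℝ) / (N - 1))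
      = ENNReal.ofReal (2 * s ^ (1/2 : ℝ)) := by
    rw [← bliss_lint_half hs0]
    apply setLIntegral_congr_fun measurableSet_Ioc
    intro t ht
    have hp := Real.rpow_pos_of_pos ht.1 (((N:ℝ) - 1) / (2 * N))
    simp only
    rw [← ENNReal.ofReal_inv_of_pos hp, ENNReal.ofReal_rpow_of_pos (inv_pos.2 hp),
      ← Real.rpow_neg ht.1.le, ← Real.rpow_mul ht.1.le]
    congr 2
    have : (N:ℝ) - 1 ≠ 0 := by linarith
    field_simp
  rw [e2] at h1
  have h2 := (pow_le_pow_left' (bliss_le h hs) N).trans h1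
  have e3 : ‖u s / s‖ₑ ^ N = ‖u s‖ₑ ^ N * ENNReal.ofReal (s ^ (-(N:ℝ))) := by
    rw [div_eq_mul_inv, enorm_mul, mul_pow]
    congr 1
    rw [Real.enorm_eq_ofReal (by positivity), ← ENNReal.ofReal_pow (by positivity),
      Real.rpow_neg hs0.le, Real.rpow_natCast, inv_pow]
  rw [e3]
  refine (mul_le_mul_left h2 _).trans ?_
  rw [mul_assoc, ← lintegral_mul_const' _ _ (by
    rw [← ENNReal.ofReal_pow (by positivity)]
    exact ENNReal.mul_ne_top ENNReal.ofReal_ne_top ENNReal.ofReal_ne_top)]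
  refine le_trans (le_of_eq ?_) (lintegral_mono_set hsub)
  apply setLIntegral_congr_fun measurableSet_Ioc
  intro t ht
  have ht0 := ht.1
  have hk : blissK N s t = ENNReal.ofReal
      (2 ^ (N - 1) * s ^ (-((N:ℝ) + 1) / 2) * t ^ (((N:ℝ) - 1) / 2)) := by
    unfold blissK
    rw [indicator_of_mem (by exact ht.2)]
  simp only
  rw [hk, mul_pow, mul_assoc, mul_comm (‖g t‖ₑ ^ N), ← ENNReal.ofReal_pow (by positivity),
    ← ENNReal.ofReal_pow (by positivity), ← ENNReal.ofReal_mul (by positivity),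
    ← ENNReal.ofReal_mul (by positivity)]
  congr 2
  have a1 : (t ^ (((N:ℝ) - 1) / (2 * N))) ^ N = t ^ (((N:ℝ) - 1) / 2) := by
    rw [← Real.rpow_mul_natCast ht0.le]
    congr 1
    field_simp
  have a2 : (s ^ (1/2:ℝ)) ^ (N - 1) * s ^ (-(N:ℝ)) = s ^ (-((N:ℝ) + 1) / 2) := by
    rw [← Real.rpow_mul_natCast hs0.le, ← Real.rpow_add hs0, Nat.cast_sub (by omega)]
    congr 1
    push_cast
    ring
  rw [a1, mul_pow, ← a2]
  ring

lemma blissK_int {N : ℕ} (hN : 2 ≤ N) {t : ℝ} (ht : 0 < t) :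
    ∫⁻ s in Ioc (0:ℝ) 1, blissK N s t ≤ ENNReal.ofReal (2 ^ N) := by
  have hN' : (2:ℝ) ≤ N := by exact_mod_cast hN
  have hlt : -((N:ℝ) + 1) / 2 < -1 := by linarith
  have hi := integrableOn_Ioi_rpow_of_lt hlt ht
  have e1 : ∫⁻ s in Ioi t, ENNReal.ofReal (s ^ (-((N:ℝ) + 1) / 2)) =
      ENNReal.ofReal (2 / (N - 1) * t ^ (-(((N:ℝ) - 1) / 2))) := by
    rw [← ofReal_integral_eq_lintegral_ofReal hi
      (by filter_upwards [ae_restrict_mem measurableSet_Ioi] with s hs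
          exact Real.rpow_nonneg (ht.trans hs).le _), integral_Ioi_rpow_of_lt hlt ht]
    congr 1
    have e : -((N:ℝ) + 1) / 2 + 1 = -(((N:ℝ) - 1) / 2) := by ring
    rw [e]
    have : (N:ℝ) - 1 ≠ 0 := by linarith
    field_simp
  calc ∫⁻ s in Ioc (0:ℝ) 1, blissK N s t ≤ ∫⁻ s, blissK N s t := setLIntegral_le_lintegral _ _
    _ = ∫⁻ s, (Ici t).indicator (fun s => ENNReal.ofReal (2 ^ (N - 1) * t ^ (((N:ℝ) - 1) / 2)) *
          ENNReal.ofReal (s ^ (-((N:ℝ) + 1) / 2))) s := by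
        apply lintegral_congr
        intro s
        unfold blissK
        by_cases hst : t ≤ s
        · rw [indicator_of_mem (by exact hst), indicator_of_mem (by exact hst),
            ← ENNReal.ofReal_mul (by positivity)]
          congr 1
          ring
        · rw [indicator_of_notMem (by exact hst), indicator_of_notMem (by exact hst)]
    _ = ENNReal.ofReal (2 ^ (N - 1) * t ^ (((N:ℝ) - 1) / 2)) *
          ENNReal.ofReal (2 / (N - 1) * t ^ (-(((N:ℝ) - 1) / 2))) := by
        rw [lintegral_indicator measurableSet_Ici, lintegral_const_mul' _ _ ENNReal.ofReal_ne_top,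
          setLIntegral_congr Ioi_ae_eq_Ici.symm, e1]
    _ ≤ _ := by
        rw [← ENNReal.ofReal_mul (by positivity)]
        apply ENNReal.ofReal_le_ofReal
        have ep : t ^ (((N:ℝ) - 1) / 2) * t ^ (-(((N:ℝ) - 1) / 2)) = 1 := by
          rw [← Real.rpow_add ht]; simp
        calc _ = 2 ^ (N - 1) * (2 / ((N:ℝ) - 1)) *
              (t ^ (((N:ℝ) - 1) / 2) * t ^ (-(((N:ℝ) - 1) / 2))) := by ring
          _ = 2 ^ (N - 1) * (2 / ((N:ℝ) - 1)) := by rw [ep, mul_one]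
          _ ≤ 2 ^ (N - 1) * 2 := by
            gcongr
            apply div_le_self (by norm_num); linarith
          _ = 2 ^ N := by rw [← pow_succ]; congr 1; omega

lemma bliss_hardy {N : ℕ} (hN : 2 ≤ N) {u g : ℝ → ℝ} (h : MemEN N u g) :
    ∫⁻ s in Ioc (0:ℝ) 1, ‖u s / s‖ₑ ^ N ≤ ENNReal.ofReal (2 ^ N) := by
  calc _ ≤ ∫⁻ s in Ioc (0:ℝ) 1, ∫⁻ t in Ioc (0:ℝ) 1, blissK N s t * ‖g t‖ₑ ^ N :=
        setLIntegral_mono' measurableSet_Ioc fun s hs => bliss_hardy_pt hN h hs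
    _ = ∫⁻ t in Ioc (0:ℝ) 1, ∫⁻ s in Ioc (0:ℝ) 1, blissK N s t * ‖g t‖ₑ ^ N := by
        apply lintegral_lintegral_swap
        apply AEMeasurable.mul
        · unfold blissK
          apply Measurable.aemeasurable
          apply Measurable.indicator
          · fun_prop
          · exact measurableSet_le measurable_snd measurable_fst
        · exact ((bliss_meas h).pow_const N).comp_snd
    _ ≤ ∫⁻ t in Ioc (0:ℝ) 1, ENNReal.ofReal (2 ^ N) * ‖g t‖ₑ ^ N := by
        apply setLIntegral_mono' measurableSet_Ioc
        intro t ht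
        rw [lintegral_mul_const' _ _ (by simp)]
        gcongr
        exact blissK_int hN ht.1
    _ = _ := by
        rw [lintegral_const_mul' _ _ (by simp), bliss_norm h, mul_one]

lemma bliss_pt {N : ℕ} (hN : 2 ≤ N) {β : ℝ} (hβ : 0 < β) (hβ1 : β ≤ 1) {u g : ℝ → ℝ}
    (h : MemEN N u g) {s : ℝ} (hs : s ∈ Ioc (0:ℝ) 1) :
    Real.exp (β * Real.log (Real.exp 1 / s) * (u s ^ N / s ^ (N - 1))) ≤
      Real.exp 1 * s ^ (-(1/2) : ℝ) + 2 * Real.exp 1 * |u s / s| ^ N := by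
  have hs0 := hs.1
  have hF1 : |u s| ^ N / s ^ (N - 1) ≤ 1 :=
    div_le_one_of_le₀ (bliss_le_one hN h hs) (by positivity)
  have hF0 : 0 ≤ |u s| ^ N / s ^ (N - 1) := by positivity
  have hle : u s ^ N / s ^ (N - 1) ≤ |u s| ^ N / s ^ (N - 1) := by
    apply div_le_div_of_nonneg_right _ (by positivity)
    rw [← abs_pow]; exact le_abs_self _
  have hFs : |u s / s| ^ N = (|u s| ^ N / s ^ (N - 1)) / s := by
    rw [abs_div, abs_of_pos hs0, div_pow, div_div, ← pow_succ]
    congr 2; omega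
  rw [hFs]
  set F := |u s| ^ N / s ^ (N - 1)
  have hlog : Real.log (Real.exp 1 / s) = 1 - Real.log s := by
    rw [Real.log_div (by positivity) hs0.ne', Real.log_exp]
  have hls : Real.log s ≤ 0 := Real.log_nonpos hs0.le hs.2
  have hb : Real.exp (β * Real.log (Real.exp 1 / s) * (u s ^ N / s ^ (N - 1))) ≤
      Real.exp ((1 - Real.log s) * F) := by
    apply Real.exp_le_exp.2
    rw [hlog]
    have h1 : 0 ≤ β * (1 - Real.log s) := mul_nonneg hβ.le (by linarith)
    have h2 : β * (1 - Real.log s) ≤ 1 * (1 - Real.log s) :=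
      mul_le_mul_of_nonneg_right hβ1 (by linarith)
    nlinarith [mul_le_mul_of_nonneg_left hle h1, mul_le_mul_of_nonneg_right h2 hF0]
  refine hb.trans ?_
  rcases le_total F (1/2) with hF | hF
  · have : Real.exp ((1 - Real.log s) * F) ≤ Real.exp 1 * s ^ (-(1/2) : ℝ) := by
      rw [Real.rpow_def_of_pos hs0, ← Real.exp_add]
      apply Real.exp_le_exp.2
      nlinarith
    have : 0 ≤ 2 * Real.exp 1 * (F / s) := by positivity
    linarith
  · have : Real.exp ((1 - Real.log s) * F) ≤ Real.exp 1 / s := by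
      rw [← Real.exp_log hs0, ← Real.exp_sub, Real.exp_log hs0]
      apply Real.exp_le_exp.2
      nlinarith
    have h2 : Real.exp 1 / s ≤ 2 * Real.exp 1 * (F / s) := by
      rw [← mul_div_assoc]
      gcongr
      nlinarith [Real.exp_pos 1]
    have : 0 ≤ Real.exp 1 * s ^ (-(1/2) : ℝ) := by positivity
    linarith

lemma bliss_upper {N : ℕ} (hN : 2 ≤ N) {β : ℝ} (hβ : 0 < β) (hβ1 : β ≤ 1) {u g : ℝ → ℝ}
    (h : MemEN N u g) : Ifun N β u ≤ Real.exp 1 * 2 + 2 * Real.exp 1 * 2 ^ N := by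
  have h1 := norm_integral_le_lintegral_norm (μ := volume.restrict (Ioc (0:ℝ) 1))
    (fun s => Real.exp (β * Real.log (Real.exp 1 / s) * (u s ^ N / s ^ (N - 1))))
  refine (le_abs_self _).trans (h1.trans ?_)
  apply ENNReal.toReal_le_of_le_ofReal (by positivity)
  calc _ ≤ ∫⁻ s in Ioc (0:ℝ) 1, (ENNReal.ofReal (Real.exp 1) * ENNReal.ofReal (s ^ (-(1/2) : ℝ)) +
        ENNReal.ofReal (2 * Real.exp 1) * ‖u s / s‖ₑ ^ N) := by
        apply setLIntegral_mono' measurableSet_Ioc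
        intro s hs
        rw [Real.enorm_eq_ofReal_abs, ← ENNReal.ofReal_pow (abs_nonneg _),
          ← ENNReal.ofReal_mul (by positivity), ← ENNReal.ofReal_mul (by positivity),
          ← ENNReal.ofReal_add (by have := hs.1; positivity) (by positivity), Real.norm_eq_abs,
          Real.abs_exp]
        exact ENNReal.ofReal_le_ofReal (bliss_pt hN hβ hβ1 h hs)
    _ ≤ ENNReal.ofReal (Real.exp 1) * ENNReal.ofReal 2 +
        ENNReal.ofReal (2 * Real.exp 1) * ENNReal.ofReal (2 ^ N) := by
        rw [lintegral_add_left (by fun_prop), lintegral_const_mul' _ _ (by simp),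
          lintegral_const_mul' _ _ ENNReal.ofReal_ne_top, bliss_lint_half one_pos]
        gcongr
        · simp
        · exact bliss_hardy hN h
    _ = _ := by
        rw [← ENNReal.ofReal_mul (by positivity), ← ENNReal.ofReal_mul (by positivity),
          ← ENNReal.ofReal_add (by positivity) (by positivity)]

/-- Test functions. -/
noncomputable def blissU (N : ℕ) (ε : ℝ) (s : ℝ) : ℝ := ε ^ (-(1 / (N:ℝ))) * min s ε

noncomputable def blissG (N : ℕ) (ε : ℝ) (s : ℝ) : ℝ :=
  (Iic ε).indicator (fun _ => ε ^ (-(1 / (N:ℝ)))) s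

lemma bliss_cN {N : ℕ} (hN : 2 ≤ N) {ε : ℝ} (hε : 0 < ε) : (ε ^ (-(1 / (N:ℝ)))) ^ N = ε⁻¹ := by
  rw [← Real.rpow_mul_natCast hε.le, ← Real.rpow_neg_one]
  congr 1
  field_simp

lemma bliss_mem {N : ℕ} (hN : 2 ≤ N) {ε : ℝ} (hε : 0 < ε) (hε1 : ε ≤ 1) :
    MemEN N (blissU N ε) (blissG N ε) := by
  have hinter : ∀ s : ℝ, Ioc (0:ℝ) s ∩ Iic ε = Ioc 0 (min s ε) := by
    intro s; ext t; simp only [mem_inter_iff, mem_Ioc, mem_Iic, le_min_iff]; tauto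
  have hpow : (fun t => |blissG N ε t| ^ N) = (Iic ε).indicator (fun _ => ε⁻¹) := by
    ext t
    unfold blissG
    by_cases ht : t ∈ Iic ε
    · rw [indicator_of_mem ht, indicator_of_mem ht, abs_of_pos (by positivity), bliss_cN hN hε]
    · rw [indicator_of_notMem ht, indicator_of_notMem ht, abs_zero, zero_pow (by omega)]
  refine ⟨?_, ?_, ?_, ?_, ?_⟩
  · intro s hs
    rw [intervalIntegral.integral_of_le hs.1]
    unfold blissG blissU
    rw [setIntegral_indicator measurableSet_Iic, hinter, setIntegral_const]
    have : 0 ≤ min s ε := le_min hs.1 hε.le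
    simp [this, mul_comm]
  · simp [blissU, hε.le]
  · rw [intervalIntegrable_iff_integrableOn_Ioc_of_le zero_le_one]
    exact (integrableOn_const (by simp)).indicator measurableSet_Iic
  · rw [hpow]
    exact (integrableOn_const (by simp)).indicator measurableSet_Iic
  · rw [hpow, setIntegral_indicator measurableSet_Iic, hinter, setIntegral_const]
    simp [hε1, hε.le, hε.ne']

lemma bliss_phi {N : ℕ} (hN : 2 ≤ N) {ε : ℝ} (hε : 0 < ε) {s : ℝ} (hs : 0 < s) (hsε : s ≤ ε) :
    blissU N ε s ^ N / s ^ (N - 1) = s / ε := by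
  unfold blissU
  rw [min_eq_left hsε, mul_pow, bliss_cN hN hε]
  have : s ^ N = s ^ (N - 1) * s := by rw [← pow_succ]; congr 1; omega
  rw [this]
  field_simp

lemma bliss_int {N : ℕ} (hN : 2 ≤ N) {β : ℝ} (hβ : 0 < β) {ε : ℝ} (hε : 0 < ε) (hε1 : ε ≤ 1) :
    IntegrableOn (fun s => Real.exp (β * Real.log (Real.exp 1 / s) *
      (blissU N ε s ^ N / s ^ (N - 1)))) (Ioc (0:ℝ) 1) := by
  have hm : Measurable (fun s => Real.exp (β * Real.log (Real.exp 1 / s) *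
      (blissU N ε s ^ N / s ^ (N - 1)))) := by
    unfold blissU; fun_prop
  apply Measure.integrableOn_of_bounded (M := Real.exp (β * (1 / ε))) (by simp)
    hm.aestronglyMeasurable
  filter_upwards [ae_restrict_mem measurableSet_Ioc] with s hs
  have hs0 := hs.1
  rw [Real.norm_eq_abs, Real.abs_exp]
  apply Real.exp_le_exp.2
  rw [mul_assoc]
  apply mul_le_mul_of_nonneg_left _ hβ.le
  have hlog : Real.log (Real.exp 1 / s) = 1 - Real.log s := by
    rw [Real.log_div (by positivity) hs0.ne', Real.log_exp]
  have hl0 : 0 ≤ Real.log (Real.exp 1 / s) := by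
    have := Real.log_nonpos hs0.le hs.2; linarith
  have hl1 : Real.log (Real.exp 1 / s) ≤ 1 / s := by
    have := Real.log_le_sub_one_of_pos (inv_pos.2 hs0)
    rw [Real.log_inv] at this
    rw [hlog, one_div]; linarith
  have hphi : blissU N ε s ^ N / s ^ (N - 1) ≤ s / ε := by
    have e : s / ε = (ε ^ (-(1 / (N:ℝ))) * s) ^ N / s ^ (N - 1) := by
      rw [mul_pow, bliss_cN hN hε]
      have : s ^ N = s ^ (N - 1) * s := by rw [← pow_succ]; congr 1; omega
      rw [this]
      field_simp
    rw [e]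
    have h0 : 0 ≤ min s ε := le_min hs0.le hε.le
    unfold blissU
    gcongr
    exact min_le_left _ _
  calc _ ≤ Real.log (Real.exp 1 / s) * (s / ε) := mul_le_mul_of_nonneg_left hphi hl0
    _ ≤ 1 / s * (s / ε) := mul_le_mul_of_nonneg_right hl1 (by positivity)
    _ = 1 / ε := by field_simp

lemma bliss_lower {N : ℕ} (hN : 2 ≤ N) {β δ : ℝ} (hβ : 0 < β) (hδ : 0 < δ) (hδ1 : δ < 1)
    {ε : ℝ} (hε : 0 < ε) (hε1 : ε ≤ 1) :
    δ * ε ^ (1 - β * (1 - δ)) ≤ Ifun N β (blissU N ε) := by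
  have hi := bliss_int hN hβ hε hε1
  have hsub : Ioc ((1 - δ) * ε) ε ⊆ Ioc 0 1 := by
    intro s hs
    exact ⟨lt_trans (mul_pos (by linarith) hε) hs.1, hs.2.trans hε1⟩
  have h1 := setIntegral_ge_of_const_le_real (c := ε ^ (-(β * (1 - δ)))) measurableSet_Ioc (by simp)
    (fun s (hs : s ∈ Ioc ((1 - δ) * ε) ε) => ?_) (hi.mono_set hsub)
  · have h2 := setIntegral_mono_set hi (by filter_upwards with s; positivity)
      (LE.le.eventuallyLE hsub)
    refine le_trans (le_of_eq ?_) (h1.trans h2)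
    rw [Real.volume_real_Ioc_of_le (by nlinarith)]
    have : ε ^ (1 - β * (1 - δ)) = ε * ε ^ (-(β * (1 - δ))) := by
      rw [sub_eq_add_neg, Real.rpow_add hε, Real.rpow_one]
    rw [this]; ring
  · have hs0 := (hsub hs).1
    rw [bliss_phi hN hε hs0 hs.2, Real.rpow_def_of_pos hε]
    apply Real.exp_le_exp.2
    rw [Real.log_div (by positivity) hs0.ne', Real.log_exp]
    have a1 : 1 - δ ≤ s / ε := by rw [le_div_iff₀ hε]; exact hs.1.le
    have a2 : Real.log s ≤ Real.log ε := Real.log_le_log hs0 hs.2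
    have a3 : Real.log ε ≤ 0 := Real.log_nonpos hε.le hε1
    calc Real.log ε * -(β * (1 - δ)) = β * (-Real.log ε) * (1 - δ) := by ring
      _ ≤ β * (1 - Real.log s) * (s / ε) := by
        apply mul_le_mul _ a1 (by linarith) (mul_nonneg hβ.le (by linarith))
        apply mul_le_mul_of_nonneg_left _ hβ.le; linarith

/-- for `β > 0`, `sup_{v ∈ E_N} I_β(v) < ∞` if and only if `β ≤ 1`. -/
theorem limiting_bliss_sup_finite_iff (N : ℕ) (hN : 2 ≤ N) (β : ℝ) (hβ : 0 < β) :
    (∃ C : ℝ, ∀ u g : ℝ → ℝ, MemEN N u g → Ifun N β u ≤ C) ↔ β ≤ 1 := by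
  constructor
  · rintro ⟨C, hC⟩
    by_contra! hb
    -- choose `δ` with `β (1 - δ) = (1 + β) / 2`
    set δ : ℝ := (β - 1) / (2 * β) with hδdef
    have hδ : 0 < δ := div_pos (by linarith) (by linarith)
    have hδ1 : δ < 1 := by rw [hδdef, div_lt_one (by linarith)]; linarith
    have he : 1 - β * (1 - δ) = -((β - 1) / 2) := by
      rw [hδdef]; field_simp; ring
    have ht : Tendsto (fun x : ℝ => δ * x ^ ((β - 1) / 2)) atTop atTop :=
      (tendsto_rpow_atTop (by linarith)).const_mul_atTop hδ
    obtain ⟨x, hx1, hx⟩ := ((eventually_ge_atTop 1).and (ht.eventually_gt_atTop C)).exists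
    have hx0 : 0 < x := by linarith
    have h1 := bliss_lower hN hβ hδ hδ1 (inv_pos.2 hx0) (inv_le_one_of_one_le₀ hx1)
    have h2 := hC _ _ (bliss_mem hN (inv_pos.2 hx0) (inv_le_one_of_one_le₀ hx1))
    rw [he, Real.rpow_neg (by positivity), Real.inv_rpow hx0.le, inv_inv] at h1
    linarith
  · intro hb
    exact ⟨_, fun u g h => bliss_upper hN hβ hb h⟩
end

section
/- Let N ≥ 2 be an integer and for v ∈ E_N define J_γ(v) = ∫₀¹ exp( ( log(e/s) + γ·log log(e/s) ) · v(s)^N / s^{N−1} ) ds. Then sup_{v ∈ E_N} J_γ(v) < ∞ if and only if γ ≤ 1. -/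
open MeasureTheory Real Set Filter

/-- The improved (log log) Bliss-Moser functional `J_γ`. -/
noncomputable def Jfun (N : ℕ) (γ : ℝ) (v : ℝ → ℝ) : ℝ :=
  ∫ s in Set.Ioc (0:ℝ) 1,
    Real.exp ((Real.log (Real.exp 1 / s) + γ * Real.log (Real.log (Real.exp 1 / s))) *
      (v s ^ N / s ^ (N - 1)))

lemma tangent_ineq (n : ℕ) (x l : ℝ) (hx : 0 ≤ x) (hl : 0 ≤ l) :
    (n + 1 : ℝ) * l ^ n * x ≤ x ^ (n + 1) + n * l ^ (n + 1) := by
  induction n with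
  | zero => simp
  | succ n ih =>
    have h1 := mul_le_mul_of_nonneg_left ih hl
    have h2 : 0 ≤ (x - l) * (x ^ (n + 1) - l ^ (n + 1)) := by
      rcases le_total l x with h | h
      · exact mul_nonneg (by linarith) (by linarith [pow_le_pow_left₀ hl h (n + 1)])
      · exact mul_nonneg_of_nonpos_of_nonpos (by linarith)
          (by linarith [pow_le_pow_left₀ hx h (n + 1)])
    push_cast
    have e1 : l * ((n + 1 : ℝ) * l ^ n * x) = (n + 1 : ℝ) * l ^ (n + 1) * x := by ring
    have e2 : x ^ (n + 1 + 1) = x * x ^ (n + 1) := by ring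
    have e3 : l ^ (n + 1 + 1) = l * l ^ (n + 1) := by ring
    rw [e1] at h1
    rw [e2, e3]
    nlinarith

lemma two_point_alg (n : ℕ) (hn : 1 ≤ n) (ρ σ κ a b A B : ℝ) (hρ : 0 < ρ) (hρσ : ρ ≤ σ)
    (hκ : 0 ≤ κ) (ha : κ * ρ ^ n ≤ a) (hb : κ * σ ^ n ≤ b)
    (hA : (n + 1 : ℝ) * (κ / ρ) ^ n * a ≤ A + n * (κ / ρ) ^ (n + 1) * ρ ^ (n + 1))
    (hB : (n + 1 : ℝ) * (κ / (2 * σ)) ^ n * (b - a) ≤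
      B + n * (κ / (2 * σ)) ^ (n + 1) * (σ ^ (n + 1) - ρ ^ (n + 1)))
    (hAB : A + B ≤ 1) :
    κ ^ (n + 1) * (1 + (1 / 2) ^ (n + 1) * (1 - ρ ^ (n + 1) / σ ^ (n + 1))) ≤ 1 := by
  have hσ : 0 < σ := by linarith
  have hlm : (κ / (2 * σ)) ^ n ≤ (κ / ρ) ^ n := by
    apply pow_le_pow_left₀ (by positivity)
    apply div_le_div_of_nonneg_left hκ hρ (by linarith)
  obtain ⟨x, rfl⟩ : ∃ x, ρ = x * σ := ⟨ρ / σ, by field_simp⟩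
  have hx0 : 0 < x := pos_of_mul_pos_left hρ hσ.le
  have hx1 : x ≤ 1 := by
    by_contra h
    push Not at h
    nlinarith
  have k1 : (n + 1 : ℝ) * ((κ / (x * σ)) ^ n - (κ / (2 * σ)) ^ n) * (κ * (x * σ) ^ n) ≤
      (n + 1 : ℝ) * ((κ / (x * σ)) ^ n - (κ / (2 * σ)) ^ n) * a := by
    apply mul_le_mul_of_nonneg_left ha
    exact mul_nonneg (by positivity) (by linarith)
  have k2 : (n + 1 : ℝ) * (κ / (2 * σ)) ^ n * (κ * σ ^ n) ≤
      (n + 1 : ℝ) * (κ / (2 * σ)) ^ n * b := by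
    apply mul_le_mul_of_nonneg_left hb
    positivity
  have e1 : (κ / (x * σ)) ^ n * (κ * (x * σ) ^ n) = κ ^ (n + 1) := by
    rw [div_pow]; field_simp; ring
  have e2 : (κ / (x * σ)) ^ (n + 1) * (x * σ) ^ (n + 1) = κ ^ (n + 1) := by
    rw [div_pow]; field_simp
  have e3 : (κ / (2 * σ)) ^ n * (κ * (x * σ) ^ n) = 2 * (κ ^ (n + 1) * (1 / 2) ^ (n + 1)) * x ^ n := by
    rw [div_pow, mul_pow, mul_pow, div_pow]; field_simp; ring
  have e4 : (κ / (2 * σ)) ^ n * (κ * σ ^ n) = 2 * (κ ^ (n + 1) * (1 / 2) ^ (n + 1)) := by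
    rw [div_pow, mul_pow, div_pow]; field_simp; ring
  have e5 : (κ / (2 * σ)) ^ (n + 1) * (σ ^ (n + 1) - (x * σ) ^ (n + 1)) =
      (κ ^ (n + 1) * (1 / 2) ^ (n + 1)) * (1 - x ^ (n + 1)) := by
    rw [div_pow, mul_pow, mul_pow, div_pow, one_pow]; field_simp
  have e6 : (x * σ) ^ (n + 1) / σ ^ (n + 1) = x ^ (n + 1) := by
    rw [mul_pow]; field_simp
  rw [e6]
  set P := κ ^ (n + 1) * (1 / 2) ^ (n + 1) with hP
  have hP0 : 0 ≤ P := by positivity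
  have hx2 : 0 ≤ 1 - 2 * x ^ n + x ^ (n + 1) := by
    have : x ^ (2 * n) ≤ x ^ (n + 1) := pow_le_pow_of_le_one hx0.le hx1 (by omega)
    have h2 : x ^ (2 * n) = x ^ n * x ^ n := by ring
    nlinarith [sq_nonneg (1 - x ^ n)]
  have hfin : 0 ≤ (n + 1 : ℝ) * P * (1 - 2 * x ^ n + x ^ (n + 1)) := by positivity
  have e7 : κ ^ (n + 1) * (1 + (1 / 2) ^ (n + 1) * (1 - x ^ (n + 1))) =
     κ ^ (n + 1) + P * (1 - x ^ (n + 1)) := by rw [hP]; ring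
  rw [e7]
  have m1 : (n + 1 : ℝ) * ((κ / (x * σ)) ^ n - (κ / (2 * σ)) ^ n) * (κ * (x * σ) ^ n) =
    (n + 1 : ℝ) * κ ^ (n + 1) - (n + 1 : ℝ) * (2 * P * x ^ n) := by
    rw [← e1, ← e3]; ring
  have m2 : (n + 1 : ℝ) * (κ / (2 * σ)) ^ n * (κ * σ ^ n) = (n + 1 : ℝ) * (2 * P) := by
    rw [← e4]; ring
  rw [m1] at k1
  rw [m2] at k2
  rw [mul_assoc (n : ℝ), e2] at hA
  rw [mul_assoc (n : ℝ), e5] at hB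
  nlinarith

/-- interval tangent inequality -/
lemma int_tangent (n : ℕ) (h : ℝ → ℝ) (hh : ∀ t, 0 ≤ h t) (a b l : ℝ) (hab : a ≤ b)
    (hl : 0 ≤ l) (hi : IntervalIntegrable h volume a b)
    (hi2 : IntervalIntegrable (fun t => h t ^ (n + 1)) volume a b) :
    (n + 1 : ℝ) * l ^ n * (∫ t in a..b, h t) ≤
      (∫ t in a..b, h t ^ (n + 1)) + n * l ^ (n + 1) * (b - a) := by
  have h1 : (∫ t in a..b, (n + 1 : ℝ) * l ^ n * h t) ≤
      ∫ t in a..b, (h t ^ (n + 1) + n * l ^ (n + 1)) := by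
    apply intervalIntegral.integral_mono_on hab (hi.const_mul _)
      (hi2.add (by simp))
    intro t _
    exact tangent_ineq n (h t) l (hh t) hl
  rw [intervalIntegral.integral_const_mul, intervalIntegral.integral_add hi2 (by simp)] at h1
  simp only [intervalIntegral.integral_const, smul_eq_mul] at h1
  linarith

/-- the setting -/
structure Good (n : ℕ) (h : ℝ → ℝ) : Prop where
  nn : ∀ t, 0 ≤ h t
  i1 : ∀ a b, 0 ≤ a → a ≤ b → b ≤ 1 → IntervalIntegrable h volume a b
  i2 : ∀ a b, 0 ≤ a → a ≤ b → b ≤ 1 → IntervalIntegrable (fun t => h t ^ (n + 1)) volume a b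
  one : ∫ t in (0:ℝ)..1, h t ^ (n + 1) = 1

noncomputable def Vf (h : ℝ → ℝ) (s : ℝ) : ℝ := ∫ t in (0:ℝ)..s, h t
noncomputable def Qf (n : ℕ) (h : ℝ → ℝ) (s : ℝ) : ℝ := Vf h s ^ (n + 1) / s ^ n

lemma Vf_nonneg {n : ℕ} {h : ℝ → ℝ} (H : Good n h) {s : ℝ} (hs : 0 ≤ s) : 0 ≤ Vf h s :=
  intervalIntegral.integral_nonneg hs (fun t _ => H.nn t)

lemma Qf_nonneg {n : ℕ} {h : ℝ → ℝ} (H : Good n h) {s : ℝ} (hs : 0 ≤ s) : 0 ≤ Qf n h s := by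
  have := Vf_nonneg H hs
  unfold Qf; positivity

lemma root_le {n : ℕ} (κ σ v : ℝ) (hσ : 0 < σ) (hv : 0 ≤ v)
    (h : κ ^ (n + 1) ≤ v ^ (n + 1) / (σ ^ (n + 1)) ^ n) : κ * σ ^ n ≤ v := by
  have h2 : (κ * σ ^ n) ^ (n + 1) ≤ v ^ (n + 1) := by
    rw [le_div_iff₀ (by positivity)] at h
    calc _ = κ ^ (n + 1) * (σ ^ (n + 1)) ^ n := by ring
      _ ≤ _ := h
  exact le_of_pow_le_pow_left₀ (by omega) hv h2

lemma two_point {n : ℕ} (hn : 1 ≤ n) {h : ℝ → ℝ} (H : Good n h) {r s m : ℝ} (hr : 0 < r)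
    (hrs : r ≤ s) (hs : s ≤ 1) (hm : 0 ≤ m) (h1 : m ≤ Qf n h r) (h2 : m ≤ Qf n h s) :
    m * (1 + (1 / 2) ^ (n + 1) * (1 - r / s)) ≤ 1 := by
  have ex : ∀ y : ℝ, 0 ≤ y → ∃ z, 0 ≤ z ∧ z ^ (n + 1) = y := fun y hy =>
    ⟨y ^ ((n + 1 : ℕ) : ℝ)⁻¹, by positivity, Real.rpow_inv_natCast_pow hy (by omega)⟩
  have hs0 : 0 < s := by linarith
  obtain ⟨ρ, hρ, rfl⟩ := ex r hr.le
  obtain ⟨σ, hσ, rfl⟩ := ex s hs0.le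
  obtain ⟨κ, hκ, rfl⟩ := ex m hm
  have hρ0 : 0 < ρ := by
    rcases hρ.eq_or_lt with h | h
    · subst h; simp at hr
    · exact h
  have hσ0 : 0 < σ := by
    rcases hσ.eq_or_lt with h | h
    · subst h; simp at hs0
    · exact h
  have hρσ : ρ ≤ σ := le_of_pow_le_pow_left₀ (by omega) hσ hrs
  have ia := H.i1 0 (ρ ^ (n + 1)) le_rfl hr.le (by linarith)
  have ib := H.i1 (ρ ^ (n + 1)) (σ ^ (n + 1)) hr.le hrs hs
  have ja := H.i2 0 (ρ ^ (n + 1)) le_rfl hr.le (by linarith)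
  have jb := H.i2 (ρ ^ (n + 1)) (σ ^ (n + 1)) hr.le hrs hs
  have jc := H.i2 (σ ^ (n + 1)) 1 hs0.le hs le_rfl
  have tA := int_tangent n h H.nn 0 (ρ ^ (n + 1)) (κ / ρ) hr.le (by positivity) ia ja
  have tB := int_tangent n h H.nn (ρ ^ (n + 1)) (σ ^ (n + 1)) (κ / (2 * σ)) hrs
    (by positivity) ib jb
  have tC : 0 ≤ ∫ t in (σ ^ (n + 1))..1, h t ^ (n + 1) :=
    intervalIntegral.integral_nonneg hs (fun t _ => pow_nonneg (H.nn t) _)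
  have s1 := intervalIntegral.integral_add_adjacent_intervals ia ib
  have s2 := intervalIntegral.integral_add_adjacent_intervals ja jb
  have s3 := intervalIntegral.integral_add_adjacent_intervals (ja.trans jb) jc
  rw [H.one] at s3
  refine two_point_alg n hn ρ σ κ (Vf h (ρ ^ (n + 1))) (Vf h (σ ^ (n + 1)))
    (∫ t in (0:ℝ)..(ρ ^ (n + 1)), h t ^ (n + 1))
    (∫ t in (ρ ^ (n + 1))..(σ ^ (n + 1)), h t ^ (n + 1)) hρ0 hρσ hκ
    (root_le κ ρ _ hρ0 (Vf_nonneg H hr.le) h1) (root_le κ σ _ hσ0 (Vf_nonneg H hs0.le) h2)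
    (by simpa [Vf] using tA) ?_ (by linarith)
  have : Vf h (σ ^ (n + 1)) - Vf h (ρ ^ (n + 1)) = ∫ t in (ρ ^ (n + 1))..(σ ^ (n + 1)), h t := by
    unfold Vf; linarith
  rw [this]
  exact tB

lemma Qf_le_energy {n : ℕ} {h : ℝ → ℝ} (H : Good n h) {s : ℝ} (hs : 0 ≤ s)
    (hs1 : s ≤ 1) : Qf n h s ≤ ∫ t in (0:ℝ)..s, h t ^ (n + 1) := by
  rcases hs.eq_or_lt with h0 | h0
  · subst h0; simp [Qf, Vf]
  have hv := Vf_nonneg H hs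
  have := int_tangent n h H.nn 0 s (Vf h s / s) hs (by positivity) (H.i1 0 s le_rfl hs hs1)
    (H.i2 0 s le_rfl hs hs1)
  have e1 : (Vf h s / s) ^ n * Vf h s = Qf n h s := by
    unfold Qf; rw [div_pow]; field_simp; ring
  have e2 : (Vf h s / s) ^ (n + 1) * (s - 0) = Qf n h s := by
    unfold Qf; rw [div_pow]; field_simp; ring
  rw [mul_assoc, mul_assoc, e2] at this
  change _ * ((Vf h s / s) ^ n * Vf h s) ≤ _ at this
  rw [e1] at this
  linarith

lemma exists_max {n : ℕ} {h : ℝ → ℝ} (H : Good n h) :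
    ∃ s₀, 0 < s₀ ∧ s₀ ≤ 1 ∧ ∀ s, 0 ≤ s → s ≤ 1 → Qf n h s ≤ Qf n h s₀ := by
  have c1 : ContinuousOn (fun s => Vf h s) (Icc 0 1) := by
    have := intervalIntegral.continuousOn_primitive_interval
      (f := h) (μ := volume) (a := 0) (b := 1) ?_
    · simpa [uIcc_of_le, Vf] using this
    · rw [uIcc_of_le zero_le_one, integrableOn_Icc_iff_integrableOn_Ioc]
      exact (intervalIntegrable_iff_integrableOn_Ioc_of_le zero_le_one).1
        (H.i1 0 1 le_rfl zero_le_one le_rfl)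
  have c2 : ContinuousOn (fun s => ∫ t in (0:ℝ)..s, h t ^ (n + 1)) (Icc 0 1) := by
    have := intervalIntegral.continuousOn_primitive_interval
      (f := fun t => h t ^ (n + 1)) (μ := volume) (a := 0) (b := 1) ?_
    · simpa [uIcc_of_le] using this
    · rw [uIcc_of_le zero_le_one, integrableOn_Icc_iff_integrableOn_Ioc]
      exact (intervalIntegrable_iff_integrableOn_Ioc_of_le zero_le_one).1
        (H.i2 0 1 le_rfl zero_le_one le_rfl)
  have c : ContinuousOn (fun s => Qf n h s) (Icc 0 1) := by
    intro s hs
    rcases hs.1.eq_or_lt with h0 | h0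
    · subst h0
      have t2 : Tendsto (fun s => ∫ t in (0:ℝ)..s, h t ^ (n + 1)) (nhdsWithin 0 (Icc 0 1))
          (nhds 0) := by
        have := c2 0 hs
        simpa [ContinuousWithinAt] using this
      have q0 : Qf n h 0 = 0 := by simp [Qf, Vf]
      unfold ContinuousWithinAt
      simp only [q0]
      refine tendsto_of_tendsto_of_tendsto_of_le_of_le' tendsto_const_nhds t2 ?_ ?_
      · filter_upwards [self_mem_nhdsWithin] with s hs using Qf_nonneg H hs.1
      · filter_upwards [self_mem_nhdsWithin] with s hs using Qf_le_energy H hs.1 hs.2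
    · unfold Qf
      exact ((c1 s hs).pow _).div (by fun_prop) (by positivity)
  obtain ⟨s₀, hs₀, hmax⟩ := isCompact_Icc.exists_isMaxOn (nonempty_Icc.2 zero_le_one) c
  have hmaxAll : ∀ s, 0 ≤ s → s ≤ 1 → Qf n h s ≤ Qf n h s₀ := fun s a b => hmax ⟨a, b⟩
  rcases hs₀.1.eq_or_lt with h0 | h0
  · refine ⟨1, one_pos, le_rfl, fun s a b => ?_⟩
    have q0 : Qf n h 0 = 0 := by simp [Qf, Vf]
    have := hmaxAll s a b
    rw [← h0, q0] at this
    exact this.trans (Qf_nonneg H zero_le_one)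
  · exact ⟨s₀, h0, hs₀.2, hmaxAll⟩

/-- concentration estimate -/
lemma conc {n : ℕ} (hn : 1 ≤ n) {h : ℝ → ℝ} (H : Good n h) :
    ∃ s₀, 0 < s₀ ∧ s₀ ≤ 1 ∧ ∀ s, 0 < s → s ≤ 1 →
      Qf n h s ≤ 1 - (1 / 2) ^ (n + 2) * (1 - min s s₀ / max s s₀) := by
  obtain ⟨s₀, h0, h1, hm⟩ := exists_max H
  refine ⟨s₀, h0, h1, fun s a b => ?_⟩
  have key : Qf n h s * (1 + (1 / 2) ^ (n + 1) * (1 - min s s₀ / max s s₀)) ≤ 1 := by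
    have q := hm s a.le b
    apply two_point hn H (lt_min a h0) min_le_max (max_le b h1) (Qf_nonneg H a.le)
    · rcases min_choice s s₀ with e | e <;> rw [e]; exact q
    · rcases max_choice s s₀ with e | e <;> rw [e]; exact q
  set d := 1 - min s s₀ / max s s₀ with hd
  have hmx : 0 < max s s₀ := lt_max_of_lt_left a
  have d1 : d ≤ 1 := by
    have : 0 ≤ min s s₀ / max s s₀ := div_nonneg (le_min a.le h0.le) hmx.le
    linarith
  have d0 : 0 ≤ d := by
    have : min s s₀ / max s s₀ ≤ 1 := (div_le_one hmx).2 min_le_max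
    linarith
  have q0 := Qf_nonneg H a.le
  have cpow : (1 / 2 : ℝ) ^ (n + 2) = (1 / 2) ^ (n + 1) / 2 := by ring
  rw [cpow]
  set c := (1 / 2 : ℝ) ^ (n + 1)
  have c0 : 0 < c := by positivity
  have c1 : c ≤ 1 := pow_le_one₀ (by norm_num) (by norm_num)
  have cd0 : 0 ≤ c * d := by positivity
  have cd1 : c * d ≤ 1 := by nlinarith
  by_contra hcon
  push Not at hcon
  nlinarith

lemma int_exp_abs (k s₀ : ℝ) (hk : 0 < k) (h0 : 0 ≤ s₀) (h1 : s₀ ≤ 1) :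
    ∫ s in Ioc (0:ℝ) 1, exp (-k * |s - s₀|) ≤ 2 / k := by
  rw [← intervalIntegral.integral_of_le zero_le_one]
  have ii : ∀ a b, IntervalIntegrable (fun s => exp (-k * |s - s₀|)) volume a b := fun a b =>
    Continuous.intervalIntegrable (by fun_prop) a b
  rw [← intervalIntegral.integral_add_adjacent_intervals (ii 0 s₀) (ii s₀ 1)]
  have a1 : ∫ s in (0:ℝ)..s₀, exp (-k * |s - s₀|) = ∫ s in (0:ℝ)..s₀, exp (k * (s - s₀)) := by
    apply intervalIntegral.integral_congr
    intro s hs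
    rw [uIcc_of_le h0] at hs
    simp only
    rw [abs_of_nonpos (by linarith [hs.2])]
    ring_nf
  have a2 : ∫ s in s₀..1, exp (-k * |s - s₀|) = ∫ s in s₀..1, exp (-k * (s - s₀)) := by
    apply intervalIntegral.integral_congr
    intro s hs
    rw [uIcc_of_le h1] at hs
    simp only
    rw [abs_of_nonneg (by linarith [hs.1])]
  have d : ∀ c : ℝ, c ≠ 0 → ∀ a b, ∫ s in a..b, exp (c * (s - s₀)) =
      exp (c * (b - s₀)) / c - exp (c * (a - s₀)) / c := by
    intro c hc a b
    apply intervalIntegral.integral_eq_sub_of_hasDerivAt (f := fun s => exp (c * (s - s₀)) / c)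
    · intro x _
      have := (((((hasDerivAt_id x).sub_const s₀).const_mul c).exp).div_const c)
      rwa [mul_one, mul_div_assoc, div_self hc, mul_one] at this
    · exact Continuous.intervalIntegrable (by fun_prop) a b
  rw [a1, a2, d k hk.ne', d (-k) (by linarith)]
  simp only [sub_self, mul_zero, exp_zero]
  have e1 : 0 < exp (k * (0 - s₀)) / k := by positivity
  have e2 : 0 < exp (-k * (1 - s₀)) / k := by positivity
  rw [div_neg, div_neg]
  have : 2 / k = 1 / k + 1 / k := by ring
  linarith

lemma ptwise (c s s₀ Q : ℝ) (hc : 0 < c) (hc1 : c ≤ 1) (hs : 0 < s) (hs1 : s ≤ 1) (h0 : 0 < s₀)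
    (h1 : s₀ ≤ 1) (hQ : Q ≤ 1 - c * (1 - min s s₀ / max s s₀)) :
    exp ((log (exp 1 / s) + log (log (exp 1 / s))) * Q) ≤
      exp 1 * (4 / c) * s ^ (c / 4 - 1) +
      4 * exp 1 * log (exp 1 / s₀) / s₀ *
        exp (-(c / 4 * log (exp 1 / s₀) / s₀) * |s - s₀|) := by
  have eL : ∀ x : ℝ, 0 < x → log (exp 1 / x) = 1 - log x := fun x hx => by
    rw [log_div (exp_pos _).ne' hx.ne', log_exp]
  have L1 : 1 ≤ log (exp 1 / s) := by rw [eL s hs]; linarith [log_nonpos hs.le hs1]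
  have M1 : 1 ≤ log (exp 1 / s₀) := by rw [eL s₀ h0]; linarith [log_nonpos h0.le h1]
  have hexp : exp (log (exp 1 / s)) = exp 1 / s := exp_log (by positivity)
  have hls : log s = 1 - log (exp 1 / s) := by rw [eL s hs]; ring
  have hls0 : log s₀ = 1 - log (exp 1 / s₀) := by rw [eL s₀ h0]; ring
  set L := log (exp 1 / s)
  set M := log (exp 1 / s₀)
  have hlL : 0 ≤ log L := log_nonneg L1
  set d := 1 - min s s₀ / max s s₀ with hd
  have hmx : 0 < max s s₀ := lt_max_of_lt_left hs
  have d0 : 0 ≤ d := by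
    have : min s s₀ / max s s₀ ≤ 1 := (div_le_one hmx).2 min_le_max
    linarith
  have b1 : exp ((L + log L) * Q) ≤ exp 1 / s * L * exp (-(c * L * d)) := by
    have e0 : exp 1 / s * L * exp (-(c * L * d)) = exp (L + log L + -(c * L * d)) := by
      rw [exp_add, exp_add, exp_log (show 0 < L by linarith), hexp]
    rw [e0]
    apply exp_le_exp.2
    have : (L + log L) * Q ≤ (L + log L) * (1 - c * d) :=
      mul_le_mul_of_nonneg_left hQ (by linarith)
    have h2 : 0 ≤ log L * (c * d) := by positivity
    nlinarith
  have p1 : 0 ≤ exp 1 * (4 / c) * s ^ (c / 4 - 1) := by positivity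
  have p2 : 0 ≤ 4 * exp 1 * M / s₀ * exp (-(c / 4 * M / s₀) * |s - s₀|) := by
    have : 0 ≤ M := by linarith
    positivity
  refine b1.trans ?_
  rcases le_or_gt (1 / 2) d with hd2 | hd2
  · refine le_trans ?_ (le_add_of_nonneg_right p2)
    have h2 : L ≤ 4 / c * exp (c * L / 4) := by
      have := add_one_le_exp (c * L / 4)
      have h3 : 4 / c * (c * L / 4) ≤ 4 / c * exp (c * L / 4) :=
        mul_le_mul_of_nonneg_left (by linarith) (by positivity)
      have h4 : 4 / c * (c * L / 4) = L := by field_simp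
      linarith
    have h3 : exp (-(c * L * d)) ≤ exp (-(c * L / 2)) := by
      apply exp_le_exp.2
      have : 0 ≤ c * L := by positivity
      nlinarith
    rw [← hexp, rpow_def_of_pos hs]
    calc exp L * L * exp (-(c * L * d)) ≤ exp L * (4 / c * exp (c * L / 4)) * exp (-(c * L / 2)) := by
          gcongr
      _ = 4 / c * (exp L * exp (c * L / 4) * exp (-(c * L / 2))) := by ring
      _ = 4 / c * exp (L + c * L / 4 + -(c * L / 2)) := by rw [exp_add, exp_add]
      _ ≤ 4 / c * exp (1 + log s * (c / 4 - 1)) := by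
          have hle : L + c * L / 4 + -(c * L / 2) ≤ 1 + log s * (c / 4 - 1) := by
            rw [hls]; nlinarith
          gcongr
      _ = exp 1 * (4 / c) * exp (log s * (c / 4 - 1)) := by rw [exp_add]; ring
  · refine le_trans ?_ (le_add_of_nonneg_left p1)
    have hmm : max s s₀ ≤ 2 * min s s₀ := by
      have h5 : 1 / 2 < min s s₀ / max s s₀ := by linarith
      rw [lt_div_iff₀ hmx] at h5
      linarith
    have hs2 : s ≤ 2 * s₀ := (le_max_left s s₀).trans (hmm.trans (by linarith [min_le_right s s₀]))
    have hs3 : s₀ ≤ 2 * s := (le_max_right s s₀).trans (hmm.trans (by linarith [min_le_left s s₀]))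
    have lg2 : log 2 < 1 := by linarith [log_two_lt_d9]
    have l1 : log s ≤ log 2 + log s₀ := by
      rw [← log_mul (by norm_num) h0.ne']; exact log_le_log hs hs2
    have l2 : log s₀ ≤ log 2 + log s := by
      rw [← log_mul (by norm_num) hs.ne']; exact log_le_log h0 hs3
    have LM : L ≤ 2 * M := by linarith
    have ML : M / 2 ≤ L := by linarith
    have hdd : |s - s₀| / (2 * s₀) ≤ d := by
      rw [hd, one_sub_div hmx.ne', max_sub_min_eq_abs, abs_sub_comm]
      apply div_le_div_of_nonneg_left (abs_nonneg _) hmx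
      exact max_le hs2 (by linarith)
    have h3 : exp (-(c * L * d)) ≤ exp (-(c / 4 * M / s₀) * |s - s₀|) := by
      apply exp_le_exp.2
      have h6 : c * (M / 2) * (|s - s₀| / (2 * s₀)) ≤ c * L * d := by gcongr
      have h7 : c * (M / 2) * (|s - s₀| / (2 * s₀)) = (c / 4 * M / s₀) * |s - s₀| := by
        field_simp; ring
      linarith
    have h4 : exp 1 / s ≤ 2 * exp 1 / s₀ := by
      rw [div_le_div_iff₀ hs h0]
      nlinarith [exp_pos 1]
    calc exp 1 / s * L * exp (-(c * L * d)) ≤ (2 * exp 1 / s₀) * (2 * M) *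
          exp (-(c / 4 * M / s₀) * |s - s₀|) := by gcongr
      _ = _ := by ring

lemma Kbound (γ L q Q : ℝ) (hγ : γ ≤ 1) (hL : 1 ≤ L) (hq : |q| ≤ Q) (hQ : Q ≤ 1) :
    exp ((L + γ * log L) * q) ≤ exp ((L + log L) * Q) + exp (|γ| * log (|γ| + 1)) := by
  have hl := log_nonneg hL
  rcases le_total 0 q with h | h
  · refine le_trans (exp_le_exp.2 ?_) (le_add_of_nonneg_right (exp_pos _).le)
    rw [abs_of_nonneg h] at hq
    calc (L + γ * log L) * q ≤ (L + log L) * q := by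
          apply mul_le_mul_of_nonneg_right _ h
          nlinarith
      _ ≤ (L + log L) * Q := mul_le_mul_of_nonneg_left hq (by linarith)
  · refine le_trans (exp_le_exp.2 ?_) (le_add_of_nonneg_left (exp_pos _).le)
    rw [abs_of_nonpos h] at hq
    have ha : 0 < |γ| + 1 := by positivity
    have hK : 0 ≤ |γ| * log (|γ| + 1) :=
      mul_nonneg (abs_nonneg _) (log_nonneg (by linarith [abs_nonneg γ]))
    have k1 : log L ≤ L / (|γ| + 1) + log (|γ| + 1) := by
      have h1 := log_le_sub_one_of_pos (show 0 < L / (|γ| + 1) by positivity)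
      rw [log_div (by linarith) ha.ne'] at h1
      linarith
    have k2 : |γ| * log L ≤ L + |γ| * log (|γ| + 1) := by
      have h2 := mul_le_mul_of_nonneg_left k1 (abs_nonneg γ)
      have h3 : |γ| * (L / (|γ| + 1)) ≤ L := by
        rw [← mul_div_assoc, div_le_iff₀ ha]
        nlinarith [abs_nonneg γ]
      linarith
    have k3 : -(L + γ * log L) ≤ |γ| * log (|γ| + 1) := by
      nlinarith [neg_abs_le γ]
    nlinarith

lemma upper (n : ℕ) (hn : 1 ≤ n) (γ : ℝ) (hγ : γ ≤ 1) : ∃ C : ℝ, ∀ u h : ℝ → ℝ, Good n h →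
    (∀ s ∈ Icc (0:ℝ) 1, |u s| ≤ Vf h s) →
    ∫ s in Ioc (0:ℝ) 1, exp ((log (exp 1 / s) + γ * log (log (exp 1 / s))) *
      (u s ^ (n + 1) / s ^ n)) ≤ C := by
  set c : ℝ := (1 / 2) ^ (n + 2) with hcdef
  have hc : 0 < c := by positivity
  have hc1 : c ≤ 1 := pow_le_one₀ (by norm_num) (by norm_num)
  set K := exp (|γ| * log (|γ| + 1))
  refine ⟨exp 1 * (4 / c) * (4 / c) + 32 * exp 1 / c + K, fun u h H hu => ?_⟩
  obtain ⟨s₀, h0, h1, hq⟩ := conc hn H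
  set M := log (exp 1 / s₀) with hM
  have M1 : 1 ≤ M := by
    rw [hM, log_div (exp_pos _).ne' h0.ne', log_exp]; linarith [log_nonpos h0.le h1]
  set k := c / 4 * M / s₀ with hk
  have hk0 : 0 < k := by positivity
  have i1 : IntegrableOn (fun s : ℝ => exp 1 * (4 / c) * s ^ (c / 4 - 1)) (Ioc 0 1) := by
    rw [← intervalIntegrable_iff_integrableOn_Ioc_of_le zero_le_one]
    exact (intervalIntegral.intervalIntegrable_rpow' (by linarith)).const_mul _
  have i2 : IntegrableOn (fun s : ℝ => 4 * exp 1 * M / s₀ * exp (-k * |s - s₀|)) (Ioc 0 1) := by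
    rw [← intervalIntegrable_iff_integrableOn_Ioc_of_le zero_le_one]
    exact Continuous.intervalIntegrable (by fun_prop) _ _
  have i3 : IntegrableOn (fun _ : ℝ => K) (Ioc 0 1) := by simp
  have v1 : ∫ s in Ioc (0:ℝ) 1, exp 1 * (4 / c) * s ^ (c / 4 - 1) = exp 1 * (4 / c) * (4 / c) := by
    rw [← intervalIntegral.integral_of_le zero_le_one, intervalIntegral.integral_const_mul,
      integral_rpow (Or.inl (by linarith))]
    rw [sub_add_cancel, one_rpow, zero_rpow (by positivity)]
    field_simp; ring
  have v2 : ∫ s in Ioc (0:ℝ) 1, 4 * exp 1 * M / s₀ * exp (-k * |s - s₀|) ≤ 32 * exp 1 / c := by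
    rw [integral_const_mul]
    calc _ ≤ 4 * exp 1 * M / s₀ * (2 / k) := by
          apply mul_le_mul_of_nonneg_left (int_exp_abs k s₀ hk0 h0.le h1)
          positivity
      _ = 32 * exp 1 / c := by rw [hk]; field_simp; ring
  have v3 : ∫ s in Ioc (0:ℝ) 1, K = K := by simp
  calc _ ≤ ∫ s in Ioc (0:ℝ) 1, (exp 1 * (4 / c) * s ^ (c / 4 - 1) +
        4 * exp 1 * M / s₀ * exp (-k * |s - s₀|) + K) := by
        apply integral_mono_of_nonneg
        · exact Eventually.of_forall fun s => (exp_pos _).le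
        · exact (i1.add i2).add i3
        · rw [EventuallyLE, ae_restrict_iff' measurableSet_Ioc]
          refine Eventually.of_forall fun s hs => ?_
          have hQ := hq s hs.1 hs.2
          have hL : 1 ≤ log (exp 1 / s) := by
            rw [log_div (exp_pos _).ne' hs.1.ne', log_exp]; linarith [log_nonpos hs.1.le hs.2]
          have hQ1 : Qf n h s ≤ 1 := by
            have hmx : 0 < max s s₀ := lt_max_of_lt_left hs.1
            have : min s s₀ / max s s₀ ≤ 1 := (div_le_one hmx).2 min_le_max
            nlinarith
          have hqq : |u s ^ (n + 1) / s ^ n| ≤ Qf n h s := by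
            rw [abs_div, abs_pow, abs_of_nonneg (pow_nonneg hs.1.le n)]
            unfold Qf
            have := hu s ⟨hs.1.le, hs.2⟩
            have := hs.1
            gcongr
          refine (Kbound γ _ _ _ hγ hL hqq hQ1).trans ?_
          exact add_le_add_left (ptwise c s s₀ _ hc hc1 hs.1 hs.2 h0 h1 hQ) _
    _ = (∫ s in Ioc (0:ℝ) 1, exp 1 * (4 / c) * s ^ (c / 4 - 1)) +
        (∫ s in Ioc (0:ℝ) 1, 4 * exp 1 * M / s₀ * exp (-k * |s - s₀|)) +
        ∫ s in Ioc (0:ℝ) 1, K := by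
        rw [← integral_add i1 i2]
        exact integral_add (i1.add i2) i3
    _ ≤ _ := by rw [v1, v3]; linarith

lemma good_of_mem {n : ℕ} {u g : ℝ → ℝ} (h : MemEN (n + 1) u g) :
    Good n (fun t => |g t|) ∧ ∀ s ∈ Icc (0:ℝ) 1, |u s| ≤ Vf (fun t => |g t|) s := by
  obtain ⟨h1, h2, h3, h4, h5⟩ := h
  have sub : ∀ a b : ℝ, 0 ≤ a → a ≤ b → b ≤ 1 → uIcc a b ⊆ uIcc 0 1 := by
    intro a b ha hab hb
    rw [uIcc_of_le hab, uIcc_of_le zero_le_one]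
    exact Icc_subset_Icc ha hb
  refine ⟨⟨fun t => abs_nonneg _, fun a b ha hab hb => h3.abs.mono_set (sub a b ha hab hb),
    fun a b ha hab hb => ?_, ?_⟩, fun s hs => ?_⟩
  · exact ((intervalIntegrable_iff_integrableOn_Ioc_of_le zero_le_one).2 h4).mono_set
      (sub a b ha hab hb)
  · rw [intervalIntegral.integral_of_le zero_le_one]; exact h5
  · rw [h1 s hs]
    exact intervalIntegral.abs_integral_le_integral_abs hs.1

lemma lower_mem (n : ℕ) (ρ ε : ℝ) (hρ : 0 < ρ) (hε : ρ ^ (n + 1) = ε) (hε1 : ε ≤ 1) :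
    MemEN (n + 1) (fun s => min s ε / ρ) ((Iic ε).indicator (fun _ => 1 / ρ)) := by
  have hε0 : 0 < ε := by rw [← hε]; positivity
  have epow : (fun t => |(Iic ε).indicator (fun _ => 1 / ρ) t| ^ (n + 1)) =
      (Iic ε).indicator (fun _ => 1 / ε) := by
    funext t
    by_cases ht : t ∈ Iic ε
    · simp only [indicator_of_mem ht]
      rw [abs_of_pos (by positivity), div_pow, hε, one_pow]
    · simp [indicator_of_notMem ht]
  have int : ∀ c s : ℝ, 0 ≤ s → ∫ t in Ioc 0 s, (Iic ε).indicator (fun _ => c) t =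
      min s ε * c := by
    intro c s hs
    rw [setIntegral_indicator measurableSet_Iic, Ioc_inter_Iic]
    simp [hs, hε0.le]
  have ing : ∀ c : ℝ, IntegrableOn ((Iic ε).indicator (fun _ => c)) (Ioc 0 1) := by
    intro c
    have : IntegrableOn (fun _ : ℝ => c) (Ioc 0 1) := by simp
    exact this.indicator measurableSet_Iic
  refine ⟨fun s hs => ?_, ?_, ?_, ?_, ?_⟩
  · rw [intervalIntegral.integral_of_le hs.1, int _ _ hs.1]; ring
  · simp [hε0.le]
  · rw [intervalIntegrable_iff_integrableOn_Ioc_of_le zero_le_one]; exact ing _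
  · rw [epow]; exact ing _
  · rw [epow, int _ _ zero_le_one, min_eq_right hε1]; field_simp

lemma lower_J (n : ℕ) (γ : ℝ) (hγ : 1 < γ) (T ρ ε : ℝ) (hT : 1 ≤ T) (hρ : 0 < ρ)
    (hε : ρ ^ (n + 1) = ε) (hεT : ε = exp 1 / exp T) :
    exp (-γ) * T ^ (γ - 1) ≤ Jfun (n + 1) γ (fun s => min s ε / ρ) := by
  have hε0 : 0 < ε := by rw [← hε]; positivity
  have hε1 : ε ≤ 1 := by
    rw [hεT, div_le_one (exp_pos _)]; exact exp_le_exp.2 hT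
  have hT0 : 0 < T := by linarith
  have hlogT : 0 ≤ log T := log_nonneg hT
  have hlT : log T ≤ T := (log_le_sub_one_of_pos hT0).trans (by linarith)
  have heε : exp 1 / ε = exp T := by rw [hεT]; field_simp
  have L1 : ∀ s ∈ Ioc (0:ℝ) 1, 1 ≤ log (exp 1 / s) := fun s hs => by
    rw [log_div (exp_pos _).ne' hs.1.ne', log_exp]; linarith [log_nonpos hs.1.le hs.2]
  unfold Jfun
  simp only [Nat.add_sub_cancel]
  set F : ℝ → ℝ := fun s => exp ((log (exp 1 / s) + γ * log (log (exp 1 / s))) *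
      ((min s ε / ρ) ^ (n + 1) / s ^ n)) with hF
  have hFi : IntegrableOn F (Ioc 0 1) := by
    apply Measure.integrableOn_of_bounded (M := exp ((1 + γ) * exp 1 / ε)) (by simp)
    · apply Measurable.aestronglyMeasurable
      rw [hF]
      fun_prop
    · rw [ae_restrict_iff' measurableSet_Ioc]
      refine Eventually.of_forall fun s hs => ?_
      rw [Real.norm_eq_abs, abs_of_pos (exp_pos _)]
      apply exp_le_exp.2
      have hs0 := hs.1
      have l1 := L1 s hs
      have l2 : log (exp 1 / s) ≤ exp 1 / s :=
        (log_le_sub_one_of_pos (by positivity)).trans (by linarith)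
      have l3 : log (log (exp 1 / s)) ≤ exp 1 / s :=
        (log_le_sub_one_of_pos (by linarith)).trans (by linarith)
      have q1 : (min s ε / ρ) ^ (n + 1) / s ^ n ≤ s / ε := by
        calc (min s ε / ρ) ^ (n + 1) / s ^ n ≤ (s / ρ) ^ (n + 1) / s ^ n := by
              gcongr
              exact min_le_left _ _
          _ = s / ε := by rw [div_pow, hε]; field_simp; ring
      have q0 : 0 ≤ (min s ε / ρ) ^ (n + 1) / s ^ n := by
        have : 0 < min s ε := lt_min hs0 hε0
        positivity
      calc _ ≤ (exp 1 / s + γ * (exp 1 / s)) * (s / ε) := by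
            apply mul_le_mul _ q1 q0 (by positivity)
            gcongr
        _ = (1 + γ) * exp 1 / ε := by field_simp
  set a := ε * (1 - 1 / T) with ha
  have hTi : 1 / T ≤ 1 := by rw [div_le_one hT0]; exact hT
  have hTi0 : 0 < 1 / T := by positivity
  have ha0 : 0 ≤ a := mul_nonneg hε0.le (by linarith)
  have hae : a ≤ ε := by nlinarith
  have hsub : Ioc a ε ⊆ Ioc 0 1 := Ioc_subset_Ioc ha0 hε1
  have step1 : ∫ s in Ioc a ε, F s ≤ ∫ s in Ioc (0:ℝ) 1, F s :=
    setIntegral_mono_set hFi (Eventually.of_forall fun s => (exp_pos _).le)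
      (LE.le.eventuallyLE hsub)
  refine le_trans ?_ step1
  have step2 := setIntegral_ge_of_const_le_real (μ := volume) (s := Ioc a ε) (f := F)
    (c := exp T * exp (γ * log T) * exp (-1 - γ)) measurableSet_Ioc (by simp) ?_ (hFi.mono_set hsub)
  · refine le_trans (le_of_eq ?_) step2
    rw [measureReal_def, Real.volume_Ioc, ENNReal.toReal_ofReal (by linarith)]
    have e1 : ε - a = ε / T := by rw [ha]; ring
    rw [e1, rpow_sub_one hT0.ne', rpow_def_of_pos hT0, ← heε, mul_comm γ]
    have : exp (-1 - γ) = exp (-γ) / exp 1 := by rw [← exp_sub]; ring_nf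
    rw [this]
    field_simp
  · intro s hs
    rw [← exp_add, ← exp_add]
    apply exp_le_exp.2
    have hs' := hsub hs
    have hs0 := hs'.1
    have q : (min s ε / ρ) ^ (n + 1) / s ^ n = s / ε := by
      rw [min_eq_left hs.2, div_pow, hε]; field_simp; ring
    rw [q]
    have l1 : T ≤ log (exp 1 / s) := by
      rw [← log_exp T, ← heε]
      apply log_le_log (by positivity)
      exact div_le_div_of_nonneg_left (exp_pos _).le hs0 hs.2
    have l2 : log T ≤ log (log (exp 1 / s)) := log_le_log hT0 l1
    have l3 : 1 - 1 / T ≤ s / ε := by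
      rw [le_div_iff₀ hε0]
      have := hs.1
      rw [ha] at this
      linarith
    have l4 : (T + γ * log T) * (1 - 1 / T) ≤
        (log (exp 1 / s) + γ * log (log (exp 1 / s))) * (s / ε) := by
      have : 0 ≤ 1 - 1 / T := by linarith
      have : 0 ≤ log (log (exp 1 / s)) := by linarith
      have : 0 ≤ log (exp 1 / s) := by linarith
      gcongr
    have l5 : (T + γ * log T) * (1 - 1 / T) = T + γ * log T - 1 - γ * (log T / T) := by
      field_simp; ring
    have l6 : log T / T ≤ 1 := (div_le_one hT0).2 hlT
    nlinarith

/-- `sup_{v ∈ E_N} J_γ(v) < ∞` if and only if `γ ≤ 1`. -/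
theorem loglog_bliss_sup_finite_iff (N : ℕ) (hN : 2 ≤ N) (γ : ℝ) :
    (∃ C : ℝ, ∀ u g : ℝ → ℝ, MemEN N u g → Jfun N γ u ≤ C) ↔ γ ≤ 1 := by
  obtain ⟨n, rfl⟩ : ∃ n, N = n + 1 := ⟨N - 1, by omega⟩
  have hn : 1 ≤ n := by omega
  constructor
  · rintro ⟨C, hC⟩
    by_contra hγ
    push Not at hγ
    have ht : Tendsto (fun T : ℝ => exp (-γ) * T ^ (γ - 1)) atTop atTop :=
      (tendsto_rpow_atTop (by linarith)).const_mul_atTop (exp_pos _)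
    obtain ⟨T, hTC, hT⟩ := ((ht.eventually_gt_atTop C).and (eventually_ge_atTop 1)).exists
    have hρ : exp ((1 - T) / (n + 1)) ^ (n + 1) = exp 1 / exp T := by
      rw [← exp_nat_mul, ← exp_sub]
      congr 1
      push_cast
      field_simp
    have hε1 : exp 1 / exp T ≤ 1 := by
      rw [div_le_one (exp_pos _)]; exact exp_le_exp.2 hT
    have h1 := hC _ _ (lower_mem n _ _ (exp_pos _) hρ hε1)
    have h2 := lower_J n γ hγ T _ _ hT (exp_pos _) hρ rfl
    linarith
  · intro hγ
    obtain ⟨C, hC⟩ := upper n hn γ hγ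
    refine ⟨C, fun u g h => ?_⟩
    obtain ⟨H, hu⟩ := good_of_mem h
    exact hC u _ H hu
end

section
/- Let N ≥ 2 be an integer and let h : [1,∞) → ℝ⁺ be continuous and increasing with h(t) → +∞ as t → ∞ and lim_{t→∞} h(t)/log log(et) = 0. Then sup_{v ∈ E_N} J_{1,h}(v) = ∞, where J_{1,h}(v) = ∫₀¹ exp( ( log(e/s) + log log(e/s) + h(1/s) ) · v(s)^N / s^{N−1} ) ds; in fact J_{1,h}(w_j) → ∞ along the infinitesimal Moser sequence. In particular the exponent in the critical inequality J_1 admits no further improvement such as an additional term log log log(e^e/s). -/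
open MeasureTheory Real Set Filter

/-- The perturbed critical functional `J_{1,h}`. -/
noncomputable def Jfunh (N : ℕ) (h : ℝ → ℝ) (v : ℝ → ℝ) : ℝ :=
  ∫ s in Set.Ioc (0:ℝ) 1,
    Real.exp ((Real.log (Real.exp 1 / s) + Real.log (Real.log (Real.exp 1 / s)) + h (1 / s)) *
      (v s ^ N / s ^ (N - 1)))

/-- The infinitesimal Moser sequence `w_j`. -/
noncomputable def moser (N j : ℕ) (t : ℝ) : ℝ :=
  if t ≤ 1 / (j : ℝ) then (j : ℝ) ^ ((1:ℝ) / N) * t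
  else (j : ℝ) ^ (-(((N:ℝ) - 1) / N))

lemma aux_pow1 (N j : ℕ) (hN : 2 ≤ N) : (((j : ℝ) ^ ((1:ℝ) / N)) ^ N) = j := by
  rw [one_div]
  exact Real.rpow_inv_natCast_pow (Nat.cast_nonneg j) (by omega)

lemma aux_pow2 (N j : ℕ) (hN : 2 ≤ N) (hj : 1 ≤ j) :
    (((j : ℝ) ^ (-(((N:ℝ) - 1) / N))) ^ N) * (j:ℝ) ^ (N - 1) = 1 := by
  have hj0 : (0:ℝ) < j := by exact_mod_cast hj
  have hN0 : (N:ℝ) ≠ 0 := by positivity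
  rw [← Real.rpow_natCast ((j : ℝ) ^ (-(((N:ℝ) - 1) / N))) N, ← Real.rpow_mul hj0.le,
    ← Real.rpow_natCast (j:ℝ) (N-1), ← Real.rpow_add hj0]
  rw [Nat.cast_sub (by omega)]
  have : -(((N:ℝ) - 1) / N) * N + ((N:ℝ) - (1:ℕ)) = 0 := by
    field_simp
    push_cast
    ring
  rw [this, Real.rpow_zero]

lemma q_eq (N j : ℕ) (hN : 2 ≤ N) (s : ℝ) (hs : 0 < s) (hsj : s ≤ 1 / (j:ℝ)) :
    moser N j s ^ N / s ^ (N - 1) = j * s := by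
  unfold moser
  rw [if_pos hsj, mul_pow, aux_pow1 N j hN, div_eq_iff (by positivity), mul_assoc, ← pow_succ']
  congr 2
  omega

lemma q_nonneg (N j : ℕ) (s : ℝ) (hs : 0 < s) :
    0 ≤ moser N j s ^ N / s ^ (N - 1) := by
  have : 0 ≤ moser N j s := by
    unfold moser
    split_ifs <;> positivity
  positivity

lemma q_le (N j : ℕ) (hN : 2 ≤ N) (hj : 1 ≤ j) (s : ℝ) (hs : 0 < s) :
    moser N j s ^ N / s ^ (N - 1) ≤ j * s := by
  have hj0 : (0:ℝ) < j := by exact_mod_cast hj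
  by_cases hsj : s ≤ 1 / (j:ℝ)
  · exact (q_eq N j hN s hs hsj).le
  · have h2 := aux_pow2 N j hN hj
    unfold moser
    rw [if_neg hsj, div_le_iff₀ (by positivity)]
    push Not at hsj
    rw [div_lt_iff₀ hj0] at hsj
    have h3 : 1 ≤ ((j:ℝ) * s) ^ N := one_le_pow₀ (by linarith)
    have h4 : ((j:ℝ) * s) ^ N = (j * s * s ^ (N-1)) * (j:ℝ) ^ (N-1) := by
      rw [mul_pow]
      obtain ⟨k, rfl⟩ : ∃ k, N = k + 1 := ⟨N - 1, by omega⟩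
      simp only [Nat.add_sub_cancel]
      ring
    have h5 : (0:ℝ) < (j:ℝ) ^ (N-1) := by positivity
    rw [h4, ← h2] at h3
    exact le_of_mul_le_mul_right h3 h5

lemma log_es (s : ℝ) (hs : 0 < s) : Real.log (Real.exp 1 / s) = 1 + Real.log (1 / s) := by
  rw [Real.log_div (Real.exp_pos 1).ne' hs.ne', Real.log_exp, one_div, Real.log_inv]
  ring

lemma moser_meas (N j : ℕ) : Measurable (moser N j) := by
  unfold moser
  exact Measurable.ite measurableSet_Iic (by fun_prop) (by fun_prop)

lemma h_bound (h : ℝ → ℝ)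
    (hmono : MonotoneOn h (Set.Ici 1))
    (hsmall : Filter.Tendsto (fun t => h t / Real.log (Real.log (Real.exp 1 * t)))
      Filter.atTop (nhds 0)) :
    ∀ᶠ t in atTop, h t ≤ 1 + Real.log t := by
  have h1 := hsmall.eventually (gt_mem_nhds (show (0:ℝ) < 1 by norm_num))
  filter_upwards [h1, eventually_gt_atTop 1] with t ht ht1
  have hl : Real.log (Real.exp 1 * t) = 1 + Real.log t := by
    rw [Real.log_mul (Real.exp_pos 1).ne' (by linarith), Real.log_exp]
  rw [hl] at ht
  have hlt : 0 < Real.log t := Real.log_pos ht1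
  have hll : 0 < Real.log (1 + Real.log t) := Real.log_pos (by linarith)
  rw [div_lt_one hll] at ht
  have := Real.log_le_sub_one_of_pos (show 0 < 1 + Real.log t by linarith)
  linarith

lemma J_integrable (N : ℕ) (hN : 2 ≤ N) (h : ℝ → ℝ)
    (hpos : ∀ t, 1 ≤ t → 0 < h t)
    (hcont : ContinuousOn h (Set.Ici 1))
    (hmono : MonotoneOn h (Set.Ici 1))
    (hb : ∀ᶠ t in atTop, h t ≤ 1 + Real.log t) (j : ℕ) (hj : 1 ≤ j) :
    IntegrableOn (fun s => 
      Real.exp ((Real.log (Real.exp 1 / s) + Real.log (Real.log (Real.exp 1 / s)) + h (1 / s)) *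
      (moser N j s ^ N / s ^ (N - 1)))) (Set.Ioc (0:ℝ) 1) := by
  obtain ⟨T, hT⟩ := (hb.and (eventually_ge_atTop 1)).exists_forall_of_atTop
  have hT1 : 1 ≤ T := (hT T le_rfl).2
  have hj0 : (0:ℝ) < j := by exact_mod_cast hj
  refine IntegrableOn.of_bound (by simp) ?_ (Real.exp (j * (3 + h T))) ?_
  · have hh : AEStronglyMeasurable (fun s : ℝ => h (1 / s)) (volume.restrict (Set.Ioc (0:ℝ) 1)) := by
      apply ContinuousOn.aestronglyMeasurable _ measurableSet_Ioc
      apply hcont.comp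
      · apply ContinuousOn.div continuousOn_const continuousOn_id
        intro x hx
        exact hx.1.ne'
      · intro x hx
        exact (one_le_div hx.1).2 hx.2
    have hm := moser_meas N j
    have h1 : Measurable (fun s : ℝ => Real.log (Real.exp 1 / s) + Real.log (Real.log (Real.exp 1 / s))) := by
      fun_prop
    have h2 : Measurable (fun s : ℝ => moser N j s ^ N / s ^ (N - 1)) := by
      fun_prop
    exact Real.continuous_exp.comp_aestronglyMeasurable
      ((h1.aestronglyMeasurable.add hh).mul h2.aestronglyMeasurable)
  · filter_upwards [ae_restrict_mem measurableSet_Ioc] with s hs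
    rw [Real.norm_eq_abs, abs_of_pos (Real.exp_pos _), Real.exp_le_exp]
    have hs0 := hs.1
    have hx1 : 1 ≤ 1 / s := (one_le_div hs.1).2 hs.2
    have hlx : 0 ≤ Real.log (1/s) := Real.log_nonneg hx1
    rw [log_es s hs0]
    have hll := Real.log_le_sub_one_of_pos (show 0 < 1 + Real.log (1/s) by linarith)
    have hhx : h (1/s) ≤ h T + (1 + Real.log (1/s)) := by
      rcases le_total T (1/s) with hc | hc
      · have := (hT _ hc).1
        have := hpos T hT1
        linarith
      · have := hmono (Set.mem_Ici.2 hx1) (Set.mem_Ici.2 hT1) hc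
        linarith
    have hlog := Real.log_le_sub_one_of_pos (show 0 < 1/s by positivity)
    have hsl : s * (1 + Real.log (1/s)) ≤ 1 := by
      calc s * (1 + Real.log (1/s)) ≤ s * (1 / s) := by gcongr; linarith
        _ = 1 := by field_simp
    have hB : 1 + Real.log (1/s) + Real.log (1 + Real.log (1/s)) + h (1/s) ≤ 3 * (1 + Real.log (1/s)) + h T := by
      linarith
    have hTp := hpos T hT1
    calc _ ≤ (3 * (1 + Real.log (1/s)) + h T) * (moser N j s ^ N / s ^ (N - 1)) := 
          mul_le_mul_of_nonneg_right hB (q_nonneg N j s hs0)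
      _ ≤ (3 * (1 + Real.log (1/s)) + h T) * (j * s) := 
          mul_le_mul_of_nonneg_left (q_le N j hN hj s hs0) (by linarith)
      _ = j * (3 * (s * (1 + Real.log (1/s))) + h T * s) := by ring
      _ ≤ j * (3 + h T) := by
          apply mul_le_mul_of_nonneg_left _ hj0.le
          have : h T * s ≤ h T := mul_le_of_le_one_right hTp.le hs.2
          linarith

lemma J_lower (N : ℕ) (hN : 2 ≤ N) (h : ℝ → ℝ)
    (hpos : ∀ t, 1 ≤ t → 0 < h t)
    (hcont : ContinuousOn h (Set.Ici 1))
    (hmono : MonotoneOn h (Set.Ici 1))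
    (hb : ∀ᶠ t in atTop, h t ≤ 1 + Real.log t) (j : ℕ) (hj : 1 ≤ j)
    (hbj : h j ≤ 1 + Real.log j) :
    Real.exp (h j) / 3 ≤ Jfunh N h (moser N j) := by
  have hj1 : (1:ℝ) ≤ j := by exact_mod_cast hj
  have hj0 : (0:ℝ) < j := by linarith
  have hlj : 0 ≤ Real.log j := Real.log_nonneg hj1
  set L := 1 + Real.log j with hL
  have hL1 : 1 ≤ L := by linarith
  have hll0 : 0 ≤ Real.log L := Real.log_nonneg hL1
  have hll := Real.log_le_sub_one_of_pos (show 0 < L by linarith)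
  have hhj := hpos j hj1
  set A := L + Real.log L + h j with hA
  have hA1 : 1 < A := by linarith
  have hA3 : A ≤ 3 * L := by linarith
  have hA0 : 0 < A := by linarith
  have hint := J_integrable N hN h hpos hcont hmono hb j hj
  have ha0 : 0 < (1 - 1/A)/j := by
    have : 1 / A < 1 := (div_lt_one hA0).2 hA1
    apply div_pos (by linarith) hj0
  have hsub : Set.Ioc ((1 - 1/A)/j) (1/(j:ℝ)) ⊆ Set.Ioc (0:ℝ) 1 := by
    apply Set.Ioc_subset_Ioc ha0.le
    rw [div_le_one hj0]
    exact hj1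
  have hmain : ∫ s in Set.Ioc ((1 - 1/A)/j) (1/(j:ℝ)), Real.exp (A - 1) ≤ Jfunh N h (moser N j) := by
    unfold Jfunh
    refine le_trans ?_ (setIntegral_mono_set hint (ae_of_all _ fun s => (Real.exp_pos _).le)
      hsub.eventuallyLE)
    apply setIntegral_mono_on (by simp) (hint.mono_set hsub) measurableSet_Ioc
    intro s hs
    have hs0 : 0 < s := ha0.trans hs.1
    rw [Real.exp_le_exp, q_eq N j hN s hs0 hs.2, log_es s hs0]
    have hjx : (j:ℝ) ≤ 1/s := by
      rw [le_div_iff₀ hs0]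
      have := hs.2
      rw [le_div_iff₀ hj0] at this
      linarith
    have e1 : Real.log j ≤ Real.log (1/s) := Real.log_le_log hj0 hjx
    have e2 : Real.log L ≤ Real.log (1 + Real.log (1/s)) := Real.log_le_log (by linarith) (by linarith)
    have e3 : h j ≤ h (1/s) := hmono (Set.mem_Ici.2 hj1) (Set.mem_Ici.2 (hj1.trans hjx)) hjx
    have e4 : 1 - 1/A ≤ j * s := by
      have := hs.1
      rw [div_lt_iff₀ hj0] at this
      linarith
    calc A - 1 = A * (1 - 1/A) := by field_simp
      _ ≤ A * (j * s) := by gcongr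
      _ ≤ _ := by
        apply mul_le_mul_of_nonneg_right _ (by positivity)
        linarith
  refine le_trans ?_ hmain
  rw [setIntegral_const, Measure.real, Real.volume_Ioc, ENNReal.toReal_ofReal, smul_eq_mul]
  · have e : Real.exp (A - 1) = j * L * Real.exp (h j) := by
      have : A - 1 = Real.log j + Real.log L + h j := by rw [hA, hL]; ring
      rw [this, Real.exp_add, Real.exp_add, Real.exp_log hj0, Real.exp_log (by linarith)]
    rw [e]
    have : (1/(j:ℝ) - (1 - 1/A)/j) * (j * L * Real.exp (h j)) = L * Real.exp (h j) / A := by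
      field_simp
      ring
    rw [this, div_le_div_iff₀ (by norm_num) hA0]
    nlinarith [Real.exp_pos (h j)]
  · rw [← sub_div]
    have : 0 < 1 / A := by positivity
    apply div_nonneg (by linarith) hj0.le

lemma moser_mem (N : ℕ) (hN : 2 ≤ N) (j : ℕ) (hj : 1 ≤ j) :
    MemEN N (moser N j) ((Set.Iic (1/(j:ℝ))).indicator fun _ => (j:ℝ) ^ ((1:ℝ)/N)) := by
  have hj1 : (1:ℝ) ≤ j := by exact_mod_cast hj
  have hj0 : (0:ℝ) < j := by linarith
  have hij : 1/(j:ℝ) ≤ 1 := (div_le_one hj0).2 hj1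
  have hij0 : 0 < 1/(j:ℝ) := by positivity
  set c := (j:ℝ) ^ ((1:ℝ)/N) with hc
  have hc0 : 0 ≤ c := by positivity
  have habs : (fun t => |(Set.Iic (1/(j:ℝ))).indicator (fun _ => c) t| ^ N)
      = (Set.Iic (1/(j:ℝ))).indicator (fun _ => (j:ℝ)) := by
    funext t
    by_cases ht : t ∈ Set.Iic (1/(j:ℝ))
    · rw [Set.indicator_of_mem ht, Set.indicator_of_mem ht, abs_of_nonneg hc0, hc, aux_pow1 N j hN]
    · rw [Set.indicator_of_notMem ht, Set.indicator_of_notMem ht, abs_zero, zero_pow (by omega)]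
  have hset : ∀ s : ℝ, Set.Ioc 0 s ∩ Set.Iic (1/(j:ℝ)) = Set.Ioc 0 (min s (1/(j:ℝ))) := by
    intro s
    ext x
    simp only [Set.mem_inter_iff, Set.mem_Ioc, Set.mem_Iic, le_min_iff]
    tauto
  refine ⟨?_, ?_, ?_, ?_, ?_⟩
  · intro s hs
    rw [intervalIntegral.integral_of_le hs.1, setIntegral_indicator measurableSet_Iic, hset,
      setIntegral_const, Measure.real, Real.volume_Ioc, sub_zero,
      ENNReal.toReal_ofReal (le_min hs.1 hij0.le), smul_eq_mul]
    unfold moser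
    split_ifs with hsj
    · rw [min_eq_left hsj, mul_comm]
    · rw [min_eq_right (not_le.1 hsj).le, hc, one_div (j:ℝ), ← Real.rpow_neg_one,
        ← Real.rpow_add hj0]
      congr 1
      have : (N:ℝ) ≠ 0 := by positivity
      field_simp
      ring
  · unfold moser
    rw [if_pos hij0.le, mul_zero]
  · rw [intervalIntegrable_iff_integrableOn_Ioc_of_le zero_le_one]
    exact (integrableOn_const (by simp)).indicator measurableSet_Iic
  · rw [habs]
    exact (integrableOn_const (by simp)).indicator measurableSet_Iic
  · rw [habs, setIntegral_indicator measurableSet_Iic, hset, min_eq_right hij,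
      setIntegral_const, Measure.real, Real.volume_Ioc, sub_zero,
      ENNReal.toReal_ofReal hij0.le, smul_eq_mul]
    field_simp

/-- the critical exponent admits no further improvement: if
`h : [1,∞) → ℝ⁺` is continuous, increasing, `h(t) → ∞` and `h(t)/log log (e t) → 0`
as `t → ∞`, then `J_{1,h}(w_j) → ∞` along the infinitesimal Moser sequence, and
`sup_{v ∈ E_N} J_{1,h}(v) = ∞`. -/
theorem Jfunh_sup_infinite (N : ℕ) (hN : 2 ≤ N) (h : ℝ → ℝ)
    (hpos : ∀ t, 1 ≤ t → 0 < h t)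
    (hcont : ContinuousOn h (Set.Ici 1))
    (hmono : MonotoneOn h (Set.Ici 1))
    (htop : Filter.Tendsto h Filter.atTop Filter.atTop)
    (hsmall : Filter.Tendsto (fun t => h t / Real.log (Real.log (Real.exp 1 * t)))
      Filter.atTop (nhds 0)) :
    Filter.Tendsto (fun j : ℕ => Jfunh N h (moser N j)) Filter.atTop Filter.atTop ∧
    (∀ C : ℝ, ∃ u g : ℝ → ℝ, MemEN N u g ∧ C < Jfunh N h u) := by
  have hb := h_bound h hmono hsmall
  have key : Filter.Tendsto (fun j : ℕ => Jfunh N h (moser N j)) Filter.atTop Filter.atTop := by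
    have hcast := tendsto_natCast_atTop_atTop (R := ℝ)
    have h1 : Filter.Tendsto (fun j : ℕ => Real.exp (h j) / 3) atTop atTop :=
      (Real.tendsto_exp_atTop.comp (htop.comp hcast)).atTop_div_const (by norm_num)
    refine tendsto_atTop_mono' _ ?_ h1
    filter_upwards [hcast.eventually hb, eventually_ge_atTop 1] with j hbj hj
    exact J_lower N hN h hpos hcont hmono hb j hj hbj
  refine ⟨key, fun C => ?_⟩
  obtain ⟨j, hC, hj⟩ := ((key.eventually_gt_atTop C).and (eventually_ge_atTop 1)).exists
  exact ⟨_, _, moser_mem N hN j hj, hC⟩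
end
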